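/- Let G = ℝ^{n+1} be a Grushin space of homogeneous dimension Q = n+2 with Q ≥ 4. Let 2 ≤ p < Q and β < Q − p. Then for every u ∈ C_0^∞(ℝ^{n+1} ∖ {o}), ∫_{ℝ^{n+1}} |∇_{ϱ,G} u|^p / ϱ^β dx dt − ((Q−p−β)/p)^p ∫_{ℝ^{n+1}} |u|^p ψ^{p/2} / ϱ^{p+β} dx dt ≥ c_p ((p−1)/p)^p · sup_{R>0} d_H(u,R)^p. -/

import Mathlib

open MeasureTheory Real

noncomputable section

/-- Points of the Grushin space `ℝ^{n+1}`. -/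
abbrev GPt (n : ℕ) := EuclideanSpace ℝ (Fin n) × ℝ

/-- Homogeneous Grushin norm `ϱ(x,t) = (|x|⁴ + 4t²)^{1/4}`. -/
def gNorm {n : ℕ} (z : GPt n) : ℝ := (‖z.1‖ ^ 4 + 4 * z.2 ^ 2) ^ ((1 : ℝ) / 4)

/-- The geometric term `ψ(x,t) = |x|²/ϱ²` (so that `|∇_G ϱ| = ψ^{1/2}`). -/
def gPsi {n : ℕ} (z : GPt n) : ℝ := ‖z.1‖ ^ 2 / gNorm z ^ 2

/-- Radial derivative `∂_ϱ u(x,t) = d/ds u(s·x/ϱ, s²·t/ϱ²)` at `s = ϱ(x,t)`. -/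
def radialDeriv {n : ℕ} (u : GPt n → ℝ) (z : GPt n) : ℝ :=
  deriv (fun s : ℝ => u ((s / gNorm z) • z.1, (s ^ 2 / gNorm z ^ 2) * z.2)) (gNorm z)

/-- The scaled function `u_R(x,t) = u(R·x/ϱ, R²·t/ϱ²)`. -/
def uScaled {n : ℕ} (R : ℝ) (u : GPt n → ℝ) (z : GPt n) : ℝ :=
  u ((R / gNorm z) • z.1, (R ^ 2 / gNorm z ^ 2) * z.2)

/-- Radial Grushin operator `L_{ϱ,G} u = ψ(∂_ϱ² u + ((Q−1)/ϱ) ∂_ϱ u)`. -/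
def radialLap {n : ℕ} (Q : ℝ) (u : GPt n → ℝ) (z : GPt n) : ℝ :=
  gPsi z * (radialDeriv (radialDeriv u) z + (Q - 1) / gNorm z * radialDeriv u z)

/-- The Grushin operator `L_G u = Δ_x u + |x|² ∂_t² u`. -/
def grushinOp {n : ℕ} (u : GPt n → ℝ) (z : GPt n) : ℝ :=
  (∑ i : Fin n,
      deriv (deriv fun s : ℝ => u (z.1 + s • EuclideanSpace.single i (1 : ℝ), z.2)) 0)
    + ‖z.1‖ ^ 2 * deriv (deriv fun s : ℝ => u (z.1, z.2 + s)) 0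

/-- The first-order operator `T_β(u) = ψ^{1/2}(∂_ϱ u + ((Q−β−2)/(2ϱ)) u)`. -/
def Tweight {n : ℕ} (Q β : ℝ) (u : GPt n → ℝ) (z : GPt n) : ℝ :=
  Real.sqrt (gPsi z) * (radialDeriv u z + (Q - β - 2) / (2 * gNorm z) * u z)

/-- The iterated operator `R_{β,k} = T_β ∘ T_{β+2} ∘ ⋯ ∘ T_{β+2k}`. -/
def Rop {n : ℕ} (Q : ℝ) : ℕ → ℝ → (GPt n → ℝ) → GPt n → ℝ
  | 0, β, u => Tweight Q β u
  | k + 1, β, u => Tweight Q β (Rop Q k (β + 2) u)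

/-- The constants `Λ_k(Q,p,β)`. -/
def Lam (Q p β : ℝ) (k : ℕ) : ℝ :=
  if k = 1 then ((Q - p - β) / p) ^ p
  else ((Q * (p - 1) + β + ((k : ℝ) - 2) * p) * (Q - β - (k : ℝ) * p) / p ^ 2) ^ p

/-- The constant `C_{2l,p,β} = ∏_{i=1}^{l} Λ_{2i}(Q,p,β)`. -/
def Ceven (Q p β : ℝ) (l : ℕ) : ℝ := ∏ i ∈ Finset.range l, Lam Q p β (2 * i + 2)

/-- The constant `C_{2l+1,p,β} = ∏_{i=0}^{l} Λ_{2i+1}(Q,p,β)`. -/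
def Codd (Q p β : ℝ) (l : ℕ) : ℝ := ∏ i ∈ Finset.range (l + 1), Lam Q p β (2 * i + 1)

/-- The constant `A_m = ((Q+m)² + (Q−4−m)²)/4`. -/
def Aconst (Q m : ℝ) : ℝ := ((Q + m) ^ 2 + (Q - 4 - m) ^ 2) / 4

/-- The constants `D_{j,m,β}` given by the iteration
`D_{j,m+1,β} = Λ_{2m+2}(Q,2,β) D_{j−2,m,β} + A_{β+4m} D_{j−1,m,β} + D_{j,m,β}`,
with `D_{0,0,β} = 1` (and vanishing off-range values). -/
def Dconst (Q β : ℝ) : ℕ → ℤ → ℝ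
  | 0, j => if j = 0 then 1 else 0
  | m + 1, j =>
      Lam Q 2 β (2 * m + 2) * Dconst Q β m (j - 2)
        + Aconst Q (β + 4 * (m : ℝ)) * Dconst Q β m (j - 1) + Dconst Q β m j

/-- The constants `B_{j,m,β,k}` given by the iteration
`B_{j,m+1,β,k} = Λ_2(Q,2,β+2k+2) B_{j−2,m,β+4,k} + A_{β+2k+2} B_{j−1,m,β+2,k+1} + B_{j,m,β,k+2}`,
with `B_{0,0,β,k} = 1` (and vanishing off-range values). -/
def Bconst (Q : ℝ) : ℕ → ℤ → ℝ → ℝ → ℝ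
  | 0, j, _, _ => if j = 0 then 1 else 0
  | m + 1, j, β, k =>
      Lam Q 2 (β + 2 * k + 2) 2 * Bconst Q m (j - 2) (β + 4) k
        + Aconst Q (β + 2 * k + 2) * Bconst Q m (j - 1) (β + 2) (k + 1)
        + Bconst Q m j β (k + 2)

/-- Surface measure `ω_n` of the unit sphere in `ℝ^n`. -/
def sphSurface (n : ℕ) : ℝ :=
  n * (volume (Metric.ball (0 : EuclideanSpace ℝ (Fin n)) 1)).toReal

/-- The integral constant `C^{Ω,m} = ω_n ∫_0^π (sin φ)^{(n+m)/2} dφ`. -/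
def COmega (n m : ℕ) : ℝ :=
  sphSurface n * ∫ φ in (0 : ℝ)..π, Real.sin φ ^ (((n : ℝ) + (m : ℝ)) / 2)

/-- The sharp Frank–Seiringer constant `c_p = min_{0<t≤1/2} [(1−t)^p − t^p + p t^{p−1}]`. -/
def cFS (p : ℝ) : ℝ :=
  sInf {y : ℝ | ∃ t : ℝ, 0 < t ∧ t ≤ 1 / 2 ∧ y = (1 - t) ^ p - t ^ p + p * t ^ (p - 1)}

/-- Compactly supported smooth test functions with (closed) support inside `s`. -/
def IsTest {n : ℕ} (s : Set (GPt n)) (u : GPt n → ℝ) : Prop :=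
  ContDiff ℝ (⊤ : ℕ∞) u ∧ HasCompactSupport u ∧ tsupport u ⊆ s

/-- A function on the Grushin space is radial if it depends only on the homogeneous norm. -/
def IsRadial {n : ℕ} (u : GPt n → ℝ) : Prop :=
  ∃ f : ℝ → ℝ, ∀ z, u z = f (gNorm z)

/-- The distance function `d_H(u,R)`. -/
def dH {n : ℕ} (Q p β R : ℝ) (u : GPt n → ℝ) : ℝ :=
  (∫ z : GPt n,
      |u z - R ^ ((Q - p - β) / p) * uScaled R u z * gNorm z ^ (-((Q - p - β) / p))| ^ p *
        gPsi z ^ (p / 2) / (|Real.log (R / gNorm z)| ^ p * gNorm z ^ (p + β))) ^ (1 / p)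

/-- The distance function `d_R(u,k,β)`. -/
def dRdist {n : ℕ} (Q p β R : ℝ) (k : ℕ) (u : GPt n → ℝ) : ℝ :=
  (∫ z : GPt n,
      (|u z| ^ ((p - 2) / 2) * u z -
          |uScaled R u z| ^ ((p - 2) / 2) * uScaled R u z *
            (gNorm z / R) ^ (-((Q - (k : ℝ) * p - β) / 2))) ^ 2 *
        gPsi z ^ (p / 2) /
        (gNorm z ^ ((k : ℝ) * p + β) * Real.log (R / gNorm z) ^ 2)) ^ ((1 : ℝ) / 2)

/-- The distance function `d_C(u,R)`. -/
def dCdist {n : ℕ} (Q p R : ℝ) (u : GPt n → ℝ) : ℝ :=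
  (∫ z in {z : GPt n | gNorm z < 1},
      |u z - Real.log (1 / gNorm z) ^ ((p - 1) / p) * R ^ ((p - 1) / p) *
          uScaled (Real.exp (-1 / R)) u z| ^ p *
        gPsi z ^ (p / 2) /
        (gNorm z ^ Q * Real.log (1 / gNorm z) ^ p *
          |Real.log (R * Real.log (1 / gNorm z))| ^ p)) ^ (1 / p)

theorem rpow_tangent_le {r x y : ℝ} (hr : 1 ≤ r) (hx : 0 ≤ x) (hy : 0 < y) :
    y ^ r + r * y ^ (r - 1) * (x - y) ≤ x ^ r := by
  have h := one_add_mul_self_le_rpow_one_add (s := x / y - 1) (by linarith [div_nonneg hx hy.le]) hr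
  rw [add_sub_cancel, div_rpow hx hy.le, le_div_iff₀ (rpow_pos_of_pos hy r)] at h
  have e : y ^ r = y ^ (r - 1) * y := by rw [rpow_sub_one hy.ne']; field_simp
  calc _ = (1 + r * (x / y - 1)) * y ^ r := by rw [e]; field_simp
    _ ≤ _ := h

theorem frankSeiringer_nonneg {p t : ℝ} (hp : 2 ≤ p) (ht : 0 < t) (ht' : t ≤ 1 / 2) :
    0 ≤ (1 - t) ^ p - t ^ p + p * t ^ (p - 1) := by
  have h1 : t ^ p ≤ (1 - t) ^ p := rpow_le_rpow ht.le (by linarith) (by linarith)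
  have h2 : 0 < t ^ (p - 1) := rpow_pos_of_pos ht _
  nlinarith

theorem cFS_nonneg {p : ℝ} (hp : 2 ≤ p) : 0 ≤ cFS p := by
  refine Real.sInf_nonneg ?_
  rintro y ⟨t, ht, ht', rfl⟩
  exact frankSeiringer_nonneg hp ht ht'

theorem cFS_le {p t : ℝ} (hp : 2 ≤ p) (ht : 0 < t) (ht' : t ≤ 1 / 2) :
    cFS p ≤ (1 - t) ^ p - t ^ p + p * t ^ (p - 1) := by
  refine csInf_le ⟨0, ?_⟩ ⟨t, ht, ht', rfl⟩
  rintro y ⟨t, ht, ht', rfl⟩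
  exact frankSeiringer_nonneg hp ht ht'

theorem cFS_le_one {p : ℝ} (hp : 2 ≤ p) : cFS p ≤ 1 := by
  have hc : ContinuousAt (fun t : ℝ => (1 - t) ^ p - t ^ p + p * t ^ (p - 1)) 0 := by
    refine ((ContinuousAt.rpow_const (by fun_prop) (Or.inr (by linarith))).sub
      (ContinuousAt.rpow_const (by fun_prop) (Or.inr (by linarith)))).add
      (continuousAt_const.mul (ContinuousAt.rpow_const (by fun_prop) (Or.inr (by linarith))))
  have hl := (hc.tendsto.mono_left (nhdsWithin_le_nhds (s := Set.Ioi 0)))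
  rw [sub_zero, one_rpow, zero_rpow (by linarith), zero_rpow (by linarith), mul_zero,
    add_zero, sub_zero] at hl
  refine ge_of_tendsto hl ?_
  filter_upwards [Ioc_mem_nhdsGT (show (0 : ℝ) < 1 / 2 by norm_num)] with t ht
  exact cFS_le hp ht.1 ht.2

theorem one_le_one_add_rpow_sub {p s : ℝ} (hp : 2 ≤ p) (hs : 0 ≤ s) :
    1 ≤ (1 + s) ^ p - s ^ p - p * s ^ (p - 1) := by
  have hd : ∀ x : ℝ, 0 < x → HasDerivAt (fun s : ℝ => (1 + s) ^ p - s ^ p - p * s ^ (p - 1))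
      (1 * p * (1 + x) ^ (p - 1) - p * x ^ (p - 1) - p * ((p - 1) * x ^ (p - 1 - 1))) x := by
    intro x hx
    exact ((((hasDerivAt_id x).const_add 1).rpow_const (Or.inr (by linarith))).sub
      (hasDerivAt_rpow_const (Or.inl hx.ne'))).sub
      ((hasDerivAt_rpow_const (Or.inl hx.ne')).const_mul p)
  have hmono : MonotoneOn (fun s : ℝ => (1 + s) ^ p - s ^ p - p * s ^ (p - 1)) (Set.Ici 0) := by
    refine monotoneOn_of_deriv_nonneg (convex_Ici 0) ?_ ?_ ?_
    · refine Continuous.continuousOn ?_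
      refine ((Continuous.rpow_const (by fun_prop) fun _ => Or.inr (by linarith)).sub
        (Continuous.rpow_const (by fun_prop) fun _ => Or.inr (by linarith))).sub
        (continuous_const.mul (Continuous.rpow_const (by fun_prop) fun _ => Or.inr (by linarith)))
    · intro x hx
      rw [interior_Ici] at hx
      exact (hd x hx).differentiableAt.differentiableWithinAt
    · intro x hx
      rw [interior_Ici] at hx
      have hx : 0 < x := hx
      rw [(hd x hx).deriv]
      have := rpow_tangent_le (r := p - 1) (x := 1 + x) (y := x) (by linarith) (by linarith) hx
      nlinarith
  have h := hmono Set.self_mem_Ici (show s ∈ Set.Ici 0 from hs) hs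
  simpa [zero_rpow (show p ≠ 0 by linarith), zero_rpow (show p - 1 ≠ 0 by linarith)] using h

theorem monotoneOn_frankSeiringer {p : ℝ} (hp : 2 ≤ p) :
    MonotoneOn (fun t : ℝ => |1 - t| ^ p - t ^ p + p * t ^ (p - 1)) (Set.Ici (1 / 2)) := by
  have hd : ∀ x : ℝ, 0 < x → HasDerivAt (fun t : ℝ => |1 - t| ^ p - t ^ p + p * t ^ (p - 1))
      (p * |1 - x| ^ (p - 2) * (1 - x) * (-1) - p * x ^ (p - 1) + p * ((p - 1) * x ^ (p - 1 - 1)))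
      x := by
    intro x hx
    have h1 : HasDerivAt (fun t : ℝ => |1 - t| ^ p) (p * |1 - x| ^ (p - 2) * (1 - x) * (-1)) x :=
      HasDerivAt.comp x (hasDerivAt_abs_rpow (1 - x) (show 1 < p by linarith))
        ((hasDerivAt_id x).const_sub 1)
    exact (h1.sub (hasDerivAt_rpow_const (Or.inl hx.ne'))).add
      ((hasDerivAt_rpow_const (Or.inl hx.ne')).const_mul p)
  refine monotoneOn_of_deriv_nonneg (convex_Ici _) ?_ ?_ ?_
  · intro x hx
    have hx : 1 / 2 ≤ x := hx
    exact (hd x (by linarith)).continuousAt.continuousWithinAt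
  · intro x hx
    rw [interior_Ici] at hx
    have hx : 1 / 2 < x := hx
    exact (hd x (by linarith)).differentiableAt.differentiableWithinAt
  · intro x hx
    rw [interior_Ici] at hx
    have hx : 1 / 2 < x := hx
    have hx0 : 0 < x := by linarith
    rw [(hd x hx0).deriv]
    have e : x ^ (p - 1) = x ^ (p - 2) * x := by
      rw [← rpow_add_one hx0.ne']; congr 1; ring
    rw [show p - 1 - 1 = p - 2 by ring]
    rcases le_total x 1 with h | h
    · have h1 : |1 - x| ^ (p - 2) ≤ x ^ (p - 2) :=
        rpow_le_rpow (abs_nonneg _) (by rw [abs_of_nonneg] <;> linarith) (by linarith)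
      have h2 : |1 - x| ^ (p - 2) * (1 - x) ≤ x ^ (p - 2) * (1 - x) :=
        mul_le_mul_of_nonneg_right h1 (by linarith)
      have h3 : 0 < x ^ (p - 2) := rpow_pos_of_pos hx0 _
      rw [e]
      have h4 : 0 ≤ (p - 1) * x ^ (p - 2) - x ^ (p - 2) * x - |1 - x| ^ (p - 2) * (1 - x) := by
        nlinarith
      nlinarith
    · have h1 := rpow_tangent_le (r := p - 1) (x := x - 1) (y := x) (by linarith) (by linarith) hx0
      have e2 : |1 - x| ^ (p - 2) * (1 - x) = - (x - 1) ^ (p - 1) := by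
        rw [abs_sub_comm, abs_of_nonneg (by linarith)]
        rcases h.eq_or_lt with rfl | h
        · simp [zero_rpow (show p - 1 ≠ 0 by linarith)]
        · rw [show p - 1 = p - 2 + 1 by ring, rpow_add_one (by linarith)]; ring
      rw [show p - 1 - 1 = p - 2 by ring] at h1
      have h4 : 0 ≤ (p - 1) * x ^ (p - 2) - x ^ (p - 1) - |1 - x| ^ (p - 2) * (1 - x) := by
        rw [e2]; linarith
      nlinarith

theorem cFS_le_abs {p : ℝ} (hp : 2 ≤ p) (t : ℝ) :
    cFS p ≤ |1 - t| ^ p - |t| ^ p + p * (|t| ^ (p - 2) * t) := by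
  have e : ∀ s : ℝ, 0 ≤ s → s ^ (p - 2) * s = s ^ (p - 1) := by
    intro s hs
    rcases hs.eq_or_lt with rfl | h
    · simp [zero_rpow (show p - 1 ≠ 0 by linarith)]
    · rw [← rpow_add_one h.ne']; congr 1; ring
  rcases le_or_gt t 0 with h | h
  · have h1 := one_le_one_add_rpow_sub hp (neg_nonneg.2 h)
    rw [← e _ (neg_nonneg.2 h)] at h1
    rw [abs_of_nonneg (by linarith : 0 ≤ 1 - t), abs_of_nonpos h]
    rw [← sub_eq_add_neg] at h1
    linarith [cFS_le_one hp]
  · rw [abs_of_pos h, e t h.le]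
    rcases le_total t (1 / 2) with h' | h'
    · rw [abs_of_nonneg (by linarith)]
      exact cFS_le hp h h'
    · have h1 := monotoneOn_frankSeiringer hp (Set.self_mem_Ici) (show t ∈ Set.Ici (1/2) from h') h'
      have h2 := cFS_le hp (show (0 : ℝ) < 1 / 2 by norm_num) le_rfl
      simp only at h1
      rw [abs_of_nonneg (by norm_num : (0 : ℝ) ≤ 1 - 1 / 2)] at h1
      linarith

/-- The sharp convexity inequality behind the remainder term. -/
theorem abs_add_rpow_ge {p : ℝ} (hp : 2 ≤ p) (a b : ℝ) :
    |a| ^ p + p * (|a| ^ (p - 2) * a) * b + cFS p * |b| ^ p ≤ |a + b| ^ p := by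
  rcases eq_or_ne b 0 with rfl | hb
  · simp [zero_rpow (show p ≠ 0 by linarith)]
  have hb' : 0 < |b| := abs_pos.2 hb
  have h := mul_le_mul_of_nonneg_right (cFS_le_abs hp (-(a / b))) (rpow_nonneg hb'.le p)
  have e1 : |1 - -(a / b)| ^ p * |b| ^ p = |a + b| ^ p := by
    rw [← mul_rpow (abs_nonneg _) hb'.le, ← abs_mul]
    congr 2; field_simp; ring
  have e2 : |-(a / b)| ^ p * |b| ^ p = |a| ^ p := by
    rw [← mul_rpow (abs_nonneg _) hb'.le, ← abs_mul, neg_mul, div_mul_cancel₀ _ hb, abs_neg]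
  have e3 : |-(a / b)| ^ (p - 2) * |b| ^ (p - 2) = |a| ^ (p - 2) := by
    rw [← mul_rpow (abs_nonneg _) hb'.le, ← abs_mul, neg_mul, div_mul_cancel₀ _ hb, abs_neg]
  have e4 : |b| ^ p = |b| ^ (p - 2) * b ^ 2 := by
    rw [← sq_abs, ← rpow_natCast, ← rpow_add hb']; congr 1; push_cast; ring
  have e5 : (|-(a / b)| ^ (p - 2) * -(a / b)) * |b| ^ p = - (|a| ^ (p - 2) * a) * b := by
    rw [e4, ← e3]; field_simp
  have : (|1 - -(a / b)| ^ p - |-(a / b)| ^ p + p * (|-(a / b)| ^ (p - 2) * -(a / b))) * |b| ^ p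
      = |a + b| ^ p - |a| ^ p - p * (|a| ^ (p - 2) * a) * b := by
    rw [← e1, ← e2]
    linear_combination p * e5
  linarith

theorem continuous_dslope_of_differentiable {g : ℝ → ℝ} (hg : Differentiable ℝ g) (a : ℝ) :
    Continuous (dslope g a) := by
  rw [← continuousOn_univ]
  exact (continuousOn_dslope Filter.univ_mem).2 ⟨hg.continuous.continuousOn, hg a⟩

/-- The boundary term of the one-dimensional Hardy inequality, written through the difference
quotient `q = dslope g a`, is `C¹`. -/
theorem hasDerivAt_mul_abs_dslope_rpow {p : ℝ} (hp : 1 < p) {g : ℝ → ℝ} (hg : Differentiable ℝ g)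
    (a s : ℝ) :
    HasDerivAt (fun s => (s - a) * |dslope g a s| ^ p)
      (p * |dslope g a s| ^ (p - 2) * dslope g a s * deriv g s - (p - 1) * |dslope g a s| ^ p)
      s := by
  have hsq : ∀ x : ℝ, |x| ^ (p - 2) * x * x = |x| ^ p := by
    intro x
    rcases eq_or_ne x 0 with rfl | hx
    · simp [zero_rpow (show p ≠ 0 by linarith)]
    · rw [mul_assoc, ← sq, ← sq_abs, ← rpow_natCast, ← rpow_add (abs_pos.2 hx)]
      congr 1; push_cast; ring
  rcases eq_or_ne s a with rfl | hs
  · have hc : ContinuousAt (fun x => |dslope g s x| ^ p) s :=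
      ((continuous_dslope_of_differentiable hg s).abs.rpow_const
        fun _ => Or.inr (by linarith)).continuousAt
    have h : HasDerivAt (fun x => (x - s) * |dslope g s x| ^ p) (|dslope g s s| ^ p) s := by
      rw [hasDerivAt_iff_tendsto_slope]
      refine (hc.tendsto.mono_left nhdsWithin_le_nhds).congr' ?_
      filter_upwards [self_mem_nhdsWithin] with x hx
      have : x - s ≠ 0 := sub_ne_zero.2 hx
      rw [slope_def_field]
      field_simp
      ring
    convert h using 1
    rw [dslope_same]
    linear_combination p * hsq (deriv g s)
  · have hsa : s - a ≠ 0 := sub_ne_zero.2 hs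
    have h1 : HasDerivAt (dslope g a) ((deriv g s - dslope g a s) / (s - a)) s := by
      have h : HasDerivAt (fun x => (g x - g a) / (x - a))
          ((deriv g s * (s - a) - (g s - g a) * 1) / (s - a) ^ 2) s :=
        ((hg s).hasDerivAt.sub_const (g a)).div ((hasDerivAt_id s).sub_const a) hsa
      refine (h.congr_of_eventuallyEq ?_).congr_deriv ?_
      · filter_upwards [isOpen_ne.mem_nhds hs] with x hx
        rw [dslope_of_ne _ hx, slope_def_field]
      · rw [dslope_of_ne _ hs, slope_def_field]
        field_simp
    have h2 := ((hasDerivAt_id s).sub_const a).mul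
      (HasDerivAt.comp s (hasDerivAt_abs_rpow (dslope g a s) hp) h1)
    refine h2.congr_deriv ?_
    have := hsq (dslope g a s)
    simp only [id, Function.comp]
    field_simp
    linear_combination -p * this

theorem hardy_remainder_pointwise {p γ : ℝ} (hp : 2 ≤ p) (hγ : 0 < γ) (g g' q : ℝ) :
    γ ^ p * |g| ^ p + cFS p * ((p - 1) / p) ^ p * |q| ^ p
      + (-γ ^ (p - 1) * (p * |g| ^ (p - 2) * g * g')
        + cFS p * ((p - 1) / p) ^ (p - 1) *
          (p * |q| ^ (p - 2) * q * g' - (p - 1) * |q| ^ p)) ≤ |g' - γ * g| ^ p := by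
  have hα : 0 < (p - 1) / p := div_pos (by linarith) (by linarith)
  have hαp : (p - 1) / p * p = p - 1 := div_mul_cancel₀ _ (by linarith)
  set α := (p - 1) / p
  have key : ∀ c x : ℝ, 0 < c → |c * x| ^ p = c ^ p * |x| ^ p ∧
      |c * x| ^ (p - 2) * (c * x) = c ^ (p - 1) * (|x| ^ (p - 2) * x) := by
    intro c x hc
    rw [abs_mul, abs_of_pos hc, mul_rpow hc.le (abs_nonneg _), mul_rpow hc.le (abs_nonneg _),
      show p - 1 = p - 2 + 1 by ring, rpow_add_one hc.ne']
    exact ⟨rfl, by ring⟩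
  have hsq : |q| ^ (p - 2) * q * q = |q| ^ p := by
    rcases eq_or_ne q 0 with rfl | hx
    · simp [zero_rpow (show p ≠ 0 by linarith)]
    · rw [mul_assoc, ← sq, ← sq_abs, ← rpow_natCast, ← rpow_add (abs_pos.2 hx)]
      congr 1; push_cast; ring
  have h1 := abs_add_rpow_ge hp (γ * (-g)) g'
  have h2 := abs_add_rpow_ge hp (α * q) (g' - α * q)
  rw [(key _ _ hγ).1, (key _ _ hγ).2, abs_neg] at h1
  rw [(key _ _ hα).1, (key _ _ hα).2] at h2
  have h3 : 0 ≤ cFS p * |g' - α * q| ^ p := mul_nonneg (cFS_nonneg hp) (rpow_nonneg (abs_nonneg _) _)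
  have e : α * q + (g' - α * q) = g' := by ring
  rw [e] at h2
  have h4 := mul_le_mul_of_nonneg_left ((le_add_of_nonneg_right h3).trans h2) (cFS_nonneg hp)
  have e1 : γ * -g + g' = g' - γ * g := by ring
  rw [e1] at h1
  have e2 : p * (α ^ (p - 1) * (|q| ^ (p - 2) * q)) * (g' - α * q)
      = α ^ (p - 1) * (p * |q| ^ (p - 2) * q * g' - (p - 1) * |q| ^ p) := by
    rw [← hsq, ← hαp]; ring
  rw [e2] at h4
  linarith

theorem hardy_remainder_line {p γ : ℝ} (hp : 2 ≤ p) (hγ : 0 < γ) {g : ℝ → ℝ}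
    (hg : ContDiff ℝ 1 g) (hs : HasCompactSupport g) (a : ℝ) :
    ∫⁻ s, ENNReal.ofReal (γ ^ p * |g s| ^ p + cFS p * ((p - 1) / p) ^ p * |dslope g a s| ^ p)
      ≤ ∫⁻ s, ENNReal.ofReal (|deriv g s - γ * g s| ^ p) := by
  have hd : Differentiable ℝ g := hg.differentiable one_ne_zero
  have hd' : Continuous (deriv g) := hg.continuous_deriv le_rfl
  have hq : Continuous (dslope g a) := continuous_dslope_of_differentiable hd a
  have hα : 0 < (p - 1) / p := div_pos (by linarith) (by linarith)
  have hK : 0 ≤ cFS p * ((p - 1) / p) ^ p := mul_nonneg (cFS_nonneg hp) (rpow_nonneg hα.le _)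
  have hpow : ∀ {f : ℝ → ℝ} {r : ℝ}, Continuous f → 0 ≤ r → Continuous fun s => |f s| ^ r :=
    fun hf hr => hf.abs.rpow_const fun _ => Or.inr hr
  set F : ℝ → ℝ := fun s => γ ^ p * |g s| ^ p + cFS p * ((p - 1) / p) ^ p * |dslope g a s| ^ p
    with hF
  set H : ℝ → ℝ := fun s => |deriv g s - γ * g s| ^ p with hH
  set Ψ : ℝ → ℝ := fun s => -γ ^ (p - 1) * |g s| ^ p +
    cFS p * ((p - 1) / p) ^ (p - 1) * ((s - a) * |dslope g a s| ^ p) with hΨ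
  set Ψ' : ℝ → ℝ := fun s => -γ ^ (p - 1) * (p * |g s| ^ (p - 2) * g s * deriv g s)
        + cFS p * ((p - 1) / p) ^ (p - 1) *
          (p * |dslope g a s| ^ (p - 2) * dslope g a s * deriv g s
            - (p - 1) * |dslope g a s| ^ p) with hΨ'
  have hp0 : 0 ≤ p := by linarith
  have hp20 : 0 ≤ p - 2 := by linarith
  have hcg := hd.continuous
  have cF : Continuous F :=
    (continuous_const.mul (hpow hcg hp0)).add (continuous_const.mul (hpow hq hp0))
  have cH : Continuous H := hpow (hd'.sub (continuous_const.mul hcg)) hp0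
  have cΨ' : Continuous Ψ' := by
    refine (continuous_const.mul (((continuous_const.mul (hpow hcg hp20)).mul hcg).mul hd')).add
      (continuous_const.mul ((((continuous_const.mul (hpow hq hp20)).mul hq).mul hd').sub
        (continuous_const.mul (hpow hq hp0))))
  have hder : ∀ s, HasDerivAt Ψ (Ψ' s) s := fun s =>
    ((HasDerivAt.comp s (hasDerivAt_abs_rpow (g s) (by linarith)) (hd s).hasDerivAt).const_mul
      _).add ((hasDerivAt_mul_abs_dslope_rpow (by linarith) hd a s).const_mul _)
  have hF0 : ∀ s, 0 ≤ F s := fun s => add_nonneg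
    (mul_nonneg (rpow_nonneg hγ.le _) (rpow_nonneg (abs_nonneg _) _))
    (mul_nonneg hK (rpow_nonneg (abs_nonneg _) _))
  have hH0 : ∀ s, 0 ≤ H s := fun s => rpow_nonneg (abs_nonneg _) _
  have hHint : Integrable H := by
    refine cH.integrable_of_hasCompactSupport ?_
    have h1 : HasCompactSupport fun s => deriv g s - γ * g s :=
      hs.deriv.sub (hs.mul_left (f := fun _ => γ))
    exact h1.comp_left (g := fun x => |x| ^ p) (by simp [zero_rpow (show p ≠ 0 by linarith)])
  have hbound : ∀ᶠ N : ℝ in Filter.atTop, ∫ s in (a - N)..(a + N), F s ≤ ∫ s, H s := by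
    have hz : ∀ᶠ N : ℝ in Filter.atTop, g (a + N) = 0 := by
      obtain ⟨r, hr⟩ := hs.isCompact.bddAbove
      filter_upwards [Filter.eventually_gt_atTop (r - a)] with N hN
      by_contra h
      have := hr (subset_tsupport g h)
      linarith
    filter_upwards [hz, Filter.eventually_ge_atTop 0] with N hN hN0
    have hab : a - N ≤ a + N := by linarith
    have hftc : ∫ s in (a - N)..(a + N), Ψ' s = Ψ (a + N) - Ψ (a - N) :=
      intervalIntegral.integral_eq_sub_of_hasDerivAt (fun s _ => hder s)
        (cΨ'.intervalIntegrable _ _)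
    have hpos : 0 ≤ Ψ (a + N) - Ψ (a - N) := by
      simp only [hΨ, hN, abs_zero, zero_rpow (show p ≠ 0 by linarith)]
      have h1 : 0 ≤ γ ^ (p - 1) * |g (a - N)| ^ p :=
        mul_nonneg (rpow_nonneg hγ.le _) (rpow_nonneg (abs_nonneg _) _)
      have h2 : 0 ≤ cFS p * ((p - 1) / p) ^ (p - 1) :=
        mul_nonneg (cFS_nonneg hp) (rpow_nonneg hα.le _)
      have h3 : 0 ≤ N * |dslope g a (a + N)| ^ p + N * |dslope g a (a - N)| ^ p :=
        add_nonneg (mul_nonneg hN0 (rpow_nonneg (abs_nonneg _) _))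
          (mul_nonneg hN0 (rpow_nonneg (abs_nonneg _) _))
      nlinarith [mul_nonneg h2 h3]
    calc ∫ s in (a - N)..(a + N), F s
        ≤ (∫ s in (a - N)..(a + N), F s) + ∫ s in (a - N)..(a + N), Ψ' s := by
          rw [hftc]; linarith
      _ = ∫ s in (a - N)..(a + N), (F s + Ψ' s) :=
          (intervalIntegral.integral_add (cF.intervalIntegrable _ _)
            (cΨ'.intervalIntegrable _ _)).symm
      _ ≤ ∫ s in (a - N)..(a + N), H s :=
          intervalIntegral.integral_mono_on hab ((cF.add cΨ').intervalIntegrable _ _)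
            (cH.intervalIntegrable _ _) fun s _ =>
              hardy_remainder_pointwise hp hγ (g s) (deriv g s) (dslope g a s)
      _ ≤ ∫ s, H s := by
          rw [intervalIntegral.integral_of_le hab]
          exact setIntegral_le_integral hHint (Filter.Eventually.of_forall hH0)
  have hta : Filter.Tendsto (fun N : ℝ => a - N) Filter.atTop Filter.atBot := by
    simpa [sub_eq_add_neg] using Filter.tendsto_atBot_add_const_left _ a
      Filter.tendsto_neg_atTop_atBot
  have htb : Filter.Tendsto (fun N : ℝ => a + N) Filter.atTop Filter.atTop :=
    Filter.tendsto_atTop_add_const_left _ a Filter.tendsto_id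
  have hFint : Integrable F := by
    refine integrable_of_intervalIntegral_norm_bounded (∫ s, H s)
      (fun N => (cF.integrableOn_Icc).mono_set Set.Ioc_subset_Icc_self) hta htb ?_
    simpa only [Real.norm_of_nonneg (hF0 _)] using hbound
  rw [← ofReal_integral_eq_lintegral_ofReal hFint (Filter.Eventually.of_forall hF0),
    ← ofReal_integral_eq_lintegral_ofReal hHint (Filter.Eventually.of_forall hH0)]
  exact ENNReal.ofReal_le_ofReal
    (le_of_tendsto (intervalIntegral_tendsto_integral hFint hta htb) hbound)

/-- The anisotropic dilation `(x,t) ↦ (e^τ x, e^{2τ} t)`. -/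
def gDil {n : ℕ} (τ : ℝ) (z : GPt n) : GPt n := (Real.exp τ • z.1, Real.exp τ ^ 2 * z.2)

theorem gNorm_nonneg {n : ℕ} (z : GPt n) : 0 ≤ gNorm z := rpow_nonneg (by positivity) _

theorem gNorm_pos {n : ℕ} {z : GPt n} (hz : z ≠ 0) : 0 < gNorm z := by
  refine rpow_pos_of_pos ?_ _
  by_cases h : z.1 = 0
  · have h2 : z.2 ≠ 0 := fun h2 => hz (Prod.ext h h2)
    positivity
  · have : 0 < ‖z.1‖ := norm_pos_iff.2 h
    positivity

theorem continuous_gNorm {n : ℕ} : Continuous (gNorm : GPt n → ℝ) :=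
  Continuous.rpow_const (by fun_prop) fun _ => Or.inr (by norm_num)

theorem gNorm_gDil {n : ℕ} (τ : ℝ) (z : GPt n) : gNorm (gDil τ z) = Real.exp τ * gNorm z := by
  have h : ‖(gDil τ z).1‖ ^ 4 + 4 * (gDil τ z).2 ^ 2
      = Real.exp τ ^ 4 * (‖z.1‖ ^ 4 + 4 * z.2 ^ 2) := by
    simp only [gDil, norm_smul, Real.norm_eq_abs, abs_of_pos (Real.exp_pos τ)]
    ring
  rw [gNorm, h, mul_rpow (by positivity) (by positivity), gNorm]
  congr 1
  rw [← rpow_natCast, ← rpow_mul (Real.exp_pos τ).le]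
  norm_num

theorem gPsi_gDil {n : ℕ} (τ : ℝ) (z : GPt n) : gPsi (gDil τ z) = gPsi z := by
  rw [gPsi, gPsi, gNorm_gDil]
  simp only [gDil, norm_smul, Real.norm_eq_abs, abs_of_pos (Real.exp_pos τ), mul_pow]
  exact mul_div_mul_left _ _ (by positivity)

theorem gDil_ne_zero {n : ℕ} (τ : ℝ) {z : GPt n} (hz : z ≠ 0) : gDil τ z ≠ 0 := by
  intro h
  have h1 := gNorm_gDil τ z
  have h0 : gNorm (0 : GPt n) = 0 := by simp [gNorm]
  rw [h, h0] at h1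
  exact (mul_pos (Real.exp_pos τ) (gNorm_pos hz)).ne h1

theorem gDil_gDil_neg {n : ℕ} (τ : ℝ) (z : GPt n) : gDil (-τ) (gDil τ z) = z := by
  have h : Real.exp (-τ) * Real.exp τ = 1 := by rw [← Real.exp_add]; simp
  refine Prod.ext ?_ ?_
  · simp [gDil, smul_smul, h]
  · simp only [gDil]
    rw [← mul_assoc, ← mul_pow, h]; ring

theorem continuous_gDil {n : ℕ} : Continuous fun w : ℝ × GPt n => gDil w.1 w.2 := by
  unfold gDil; fun_prop

theorem radialDeriv_eq {n : ℕ} {u : GPt n → ℝ} (hu : Differentiable ℝ u) (z : GPt n) :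
    radialDeriv u z = fderiv ℝ u z ((1 / gNorm z) • z.1, 2 / gNorm z * z.2) := by
  have h1 : HasDerivAt (fun s : ℝ => (((s / gNorm z) • z.1, (s ^ 2 / gNorm z ^ 2) * z.2) : GPt n))
      ((1 / gNorm z) • z.1, 2 / gNorm z * z.2) (gNorm z) := by
    refine HasDerivAt.prodMk (((hasDerivAt_id _).div_const _).smul_const _) ?_
    have := (((hasDerivAt_pow 2 (gNorm z)).div_const (gNorm z ^ 2)).mul_const z.2)
    refine this.congr_deriv ?_
    rcases eq_or_ne (gNorm z) 0 with h | h
    · simp [h]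
    · field_simp
      ring
  rcases eq_or_ne z 0 with rfl | hz
  · have h0 : radialDeriv u 0 = 0 := by simp [radialDeriv]
    rw [h0, Prod.fst_zero, Prod.snd_zero, smul_zero, mul_zero]
    exact ((fderiv ℝ u 0).map_zero).symm
  have hρ := (gNorm_pos hz).ne'
  have e : (((gNorm z / gNorm z) • z.1, (gNorm z ^ 2 / gNorm z ^ 2) * z.2) : GPt n) = z := by
    rw [div_self hρ, div_self (pow_ne_zero 2 hρ), one_smul, one_mul]
  have h2 : HasFDerivAt u (fderiv ℝ u z)
      (((gNorm z / gNorm z) • z.1, (gNorm z ^ 2 / gNorm z ^ 2) * z.2) : GPt n) := by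
    rw [e]; exact (hu z).hasFDerivAt
  exact (HasFDerivAt.comp_hasDerivAt (gNorm z) h2 h1).deriv

theorem hasDerivAt_comp_gDil {n : ℕ} {u : GPt n → ℝ} (hu : Differentiable ℝ u) {z : GPt n}
    (hz : z ≠ 0) (τ : ℝ) :
    HasDerivAt (fun τ => u (gDil τ z)) (Real.exp τ * gNorm z * radialDeriv u (gDil τ z)) τ := by
  have h1 : HasDerivAt (fun τ => gDil τ z)
      ((Real.exp τ * gNorm z) • ((1 / gNorm (gDil τ z)) • (gDil τ z).1,
        2 / gNorm (gDil τ z) * (gDil τ z).2)) τ := by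
    have hρ := (gNorm_pos hz).ne'
    have : HasDerivAt (fun τ => gDil τ z) (Real.exp τ • z.1, 2 * Real.exp τ ^ 2 * z.2) τ := by
      refine HasDerivAt.prodMk ((Real.hasDerivAt_exp τ).smul_const z.1) ?_
      refine (((Real.hasDerivAt_exp τ).pow 2).mul_const z.2).congr_deriv ?_
      ring
    refine this.congr_deriv ?_
    rw [gNorm_gDil]
    refine Prod.ext ?_ ?_
    · simp only [Prod.smul_fst, gDil, smul_smul]
      congr 1
      field_simp
    · simp only [Prod.smul_snd, gDil, smul_eq_mul]
      field_simp
  rw [radialDeriv_eq hu]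
  refine (HasFDerivAt.comp_hasDerivAt τ (hu (gDil τ z)).hasFDerivAt h1).congr_deriv ?_
  rw [map_smul, smul_eq_mul]

theorem lintegral_comp_gDil {n : ℕ} (τ : ℝ) {F : GPt n → ENNReal} (hF : Measurable F) :
    ∫⁻ z, ENNReal.ofReal (Real.exp (((n : ℝ) + 2) * τ)) * F (gDil τ z) = ∫⁻ z, F z := by
  have hm : Measurable (gDil τ : GPt n → GPt n) :=
    (continuous_gDil.comp (Continuous.prodMk_right τ)).measurable
  have he : Real.exp τ ≠ 0 := (Real.exp_pos τ).ne'
  have he2 : Real.exp τ ^ 2 ≠ 0 := pow_ne_zero 2 he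
  have hmap : Measure.map (gDil τ : GPt n → GPt n) volume
      = ENNReal.ofReal (Real.exp (-(((n : ℝ) + 2) * τ))) • volume := by
    have h1 : (gDil τ : GPt n → GPt n)
        = Prod.map (fun x => Real.exp τ • x) (fun t : ℝ => (Real.exp τ ^ 2) • t) := rfl
    rw [h1, Measure.volume_eq_prod, ← Measure.map_prod_map _ _ (by fun_prop) (by fun_prop),
      Measure.map_addHaar_smul _ he, Measure.map_addHaar_smul _ he2, Measure.prod_smul_left,
      Measure.prod_smul_right, smul_smul, ← ENNReal.ofReal_mul (abs_nonneg _)]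
    congr 2
    rw [abs_of_pos (by positivity), abs_of_pos (by positivity), finrank_euclideanSpace_fin,
      Module.finrank_self, pow_one, ← Real.exp_nat_mul, ← Real.exp_nat_mul, ← Real.exp_neg,
      ← Real.exp_neg, ← Real.exp_add]
    congr 1
    push_cast
    ring
  rw [lintegral_const_mul _ (show Measurable fun z => F (gDil τ z) from hF.comp hm), ← lintegral_map hF hm, hmap, lintegral_smul_measure,
    smul_eq_mul, ← mul_assoc, ← ENNReal.ofReal_mul (Real.exp_pos _).le, ← Real.exp_add]
  simp

/-- Integration along the orbits of the dilation group, over the fundamental domain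
`1 ≤ ϱ < e`. -/
theorem lintegral_eq_lintegral_orbits {n : ℕ} {F : GPt n → ENNReal} (hF : Measurable F) :
    ∫⁻ z, F z = ∫⁻ z in {z : GPt n | gNorm z ∈ Set.Ico 1 (Real.exp 1)},
      ∫⁻ τ, ENNReal.ofReal (Real.exp (((n : ℝ) + 2) * τ)) * F (gDil τ z) := by
  set S : Set (GPt n) := {z | gNorm z ∈ Set.Ico 1 (Real.exp 1)} with hS
  have hSm : MeasurableSet S := continuous_gNorm.measurable measurableSet_Ico
  have hD : Measurable fun w : ℝ × GPt n => gDil w.1 w.2 := continuous_gDil.measurable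
  have hDn : Measurable fun w : ℝ × GPt n => gDil (-w.1) w.2 :=
    (continuous_gDil.comp (by fun_prop : Continuous fun w : ℝ × GPt n => (-w.1, w.2))).measurable
  set χ : GPt n → ENNReal := S.indicator 1 with hχ
  have hχm : Measurable χ := measurable_one.indicator hSm
  have hone : ∀ z : GPt n, z ≠ 0 → ∫⁻ τ, χ (gDil (-τ) z) = 1 := by
    intro z hz
    have hρ := gNorm_pos hz
    have e : (fun τ => χ (gDil (-τ) z))
        = (Set.Ioc (Real.log (gNorm z) - 1) (Real.log (gNorm z))).indicator 1 := by
      ext τ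
      have : gDil (-τ) z ∈ S ↔ τ ∈ Set.Ioc (Real.log (gNorm z) - 1) (Real.log (gNorm z)) := by
        have h : gNorm (gDil (-τ) z) = Real.exp (Real.log (gNorm z) - τ) := by
          rw [gNorm_gDil, sub_eq_add_neg, Real.exp_add, Real.exp_log hρ, mul_comm]
        rw [hS, Set.mem_ofPred_eq, h, Set.mem_Ico, Set.mem_Ioc, Real.one_le_exp_iff,
          Real.exp_lt_exp]
        constructor <;> rintro ⟨h1, h2⟩ <;> constructor <;> linarith
      by_cases h : gDil (-τ) z ∈ S
      · rw [hχ, Set.indicator_of_mem h, Set.indicator_of_mem (this.1 h)]; rfl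
      · rw [hχ, Set.indicator_of_notMem h, Set.indicator_of_notMem (fun h' => h (this.2 h'))]
    rw [e, lintegral_indicator_one measurableSet_Ioc]
    simp
  have hFD : Measurable fun w : ℝ × GPt n =>
      ENNReal.ofReal (Real.exp (((n : ℝ) + 2) * w.1)) * F (gDil w.1 w.2) :=
    (Measurable.ennreal_ofReal (by fun_prop)).mul (hF.comp hD)
  calc ∫⁻ z, F z = ∫⁻ z, ∫⁻ τ, F z * χ (gDil (-τ) z) := by
        refine lintegral_congr_ae ?_
        have h0 : (volume : Measure (GPt n)) {0} = 0 := by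
          rw [Measure.volume_eq_prod]; exact measure_singleton _
        filter_upwards [compl_mem_ae_iff.2 h0] with z hz
        rw [lintegral_const_mul _ (show Measurable fun τ => χ (gDil (-τ) z) from
          hχm.comp (hDn.comp measurable_prodMk_right)), hone z hz, mul_one]
    _ = ∫⁻ τ, ∫⁻ z, F z * χ (gDil (-τ) z) := by
        refine lintegral_lintegral_swap (Measurable.aemeasurable ?_)
        exact (hF.comp measurable_fst).mul (hχm.comp (hDn.comp measurable_swap))
    _ = ∫⁻ τ, ∫⁻ z, ENNReal.ofReal (Real.exp (((n : ℝ) + 2) * τ)) * F (gDil τ z) * χ z := by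
        refine lintegral_congr fun τ => ?_
        rw [← lintegral_comp_gDil τ (F := fun z => F z * χ (gDil (-τ) z))
          (hF.mul (hχm.comp (hDn.comp measurable_prodMk_left)))]
        refine lintegral_congr fun z => ?_
        rw [gDil_gDil_neg, mul_assoc]
    _ = ∫⁻ z, ∫⁻ τ, ENNReal.ofReal (Real.exp (((n : ℝ) + 2) * τ)) * F (gDil τ z) * χ z :=
        lintegral_lintegral_swap (hFD.mul (hχm.comp measurable_snd)).aemeasurable
    _ = _ := by
        rw [← lintegral_indicator hSm]
        refine lintegral_congr fun z => ?_
        rw [lintegral_mul_const _ (show Measurable fun τ =>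
          ENNReal.ofReal (Real.exp (((n : ℝ) + 2) * τ)) * F (gDil τ z) from
          hFD.comp measurable_prodMk_right)]
        by_cases h : z ∈ S
        · rw [Set.indicator_of_mem h, hχ, Set.indicator_of_mem h]; simp
        · rw [Set.indicator_of_notMem h, hχ, Set.indicator_of_notMem h]; simp

theorem hasCompactSupport_comp_gDil {n : ℕ} {u : GPt n → ℝ} (hu : HasCompactSupport u)
    (hu0 : tsupport u ⊆ {z | z ≠ 0}) {z : GPt n} (hz : z ≠ 0) :
    HasCompactSupport fun τ => u (gDil τ z) := by
  obtain ⟨m, hm, hm'⟩ := hu.isCompact.exists_forall_le' continuous_gNorm.continuousOn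
    fun w hw => gNorm_pos (hu0 hw)
  obtain ⟨M, hM⟩ := hu.isCompact.bddAbove_image continuous_gNorm.continuousOn
  have hρ := gNorm_pos hz
  refine HasCompactSupport.intro
    (isCompact_Icc (a := Real.log (m / gNorm z)) (b := Real.log (M / gNorm z))) fun τ hτ => ?_
  by_contra h
  have hmem := subset_tsupport u h
  have h1 := hm' _ hmem
  have h2 := hM (Set.mem_image_of_mem _ hmem)
  rw [gNorm_gDil] at h1 h2
  refine hτ ⟨?_, ?_⟩
  · rw [Real.log_le_iff_le_exp (div_pos hm hρ), div_le_iff₀ hρ]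
    exact h1
  · rw [Real.le_log_iff_exp_le (div_pos (by nlinarith [Real.exp_pos τ]) hρ), le_div_iff₀ hρ]
    exact h2

theorem radialDeriv_eq_inv_mul {n : ℕ} {u : GPt n → ℝ} (hu : Differentiable ℝ u) (z : GPt n) :
    radialDeriv u z = (gNorm z)⁻¹ * fderiv ℝ u z (z.1, 2 * z.2) := by
  rw [radialDeriv_eq hu, ← smul_eq_mul (gNorm z)⁻¹, ← map_smul]
  congr 1
  refine Prod.ext ?_ ?_
  · simp
  · simp only [Prod.smul_snd, smul_eq_mul]; ring

theorem measurable_gPsi {n : ℕ} : Measurable (gPsi : GPt n → ℝ) := by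
  have := (continuous_gNorm (n := n)).measurable
  unfold gPsi
  fun_prop

theorem measurable_radialDeriv {n : ℕ} {u : GPt n → ℝ} (hu : ContDiff ℝ 1 u) :
    Measurable (radialDeriv u) := by
  rw [funext (radialDeriv_eq_inv_mul (hu.differentiable one_ne_zero))]
  have h1 : Continuous fun z : GPt n => fderiv ℝ u z (z.1, 2 * z.2) :=
    (hu.continuous_fderiv one_ne_zero).clm_apply (by fun_prop)
  exact continuous_gNorm.measurable.inv.mul h1.measurable

theorem measurable_uScaled {n : ℕ} {u : GPt n → ℝ} (hu : Continuous u) (R : ℝ) :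
    Measurable (uScaled R u) := by
  have := (continuous_gNorm (n := n)).measurable
  have h : Measurable fun z : GPt n =>
      (((R / gNorm z) • z.1, (R ^ 2 / gNorm z ^ 2) * z.2) : GPt n) := by fun_prop
  exact hu.measurable.comp h

theorem integrable_radial_energy {n : ℕ} {p : ℝ} (hp : 0 < p) (β : ℝ) {u : GPt n → ℝ}
    (hu : ContDiff ℝ 1 u) (hc : HasCompactSupport u) (hu0 : tsupport u ⊆ {z | z ≠ 0}) :
    Integrable fun z => gPsi z ^ (p / 2) * |radialDeriv u z| ^ p / gNorm z ^ β := by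
  have hd := hu.differentiable one_ne_zero
  have h1 : Continuous fun z : GPt n => fderiv ℝ u z (z.1, 2 * z.2) :=
    (hu.continuous_fderiv one_ne_zero).clm_apply (by fun_prop)
  have hN : ContinuousOn (gNorm : GPt n → ℝ) {z | z ≠ 0} := continuous_gNorm.continuousOn
  have hN0 : ∀ z ∈ {z : GPt n | z ≠ 0}, gNorm z ≠ 0 := fun z hz => (gNorm_pos hz).ne'
  have hψ : ContinuousOn (gPsi : GPt n → ℝ) {z | z ≠ 0} :=
    (Continuous.continuousOn (by fun_prop)).div (hN.pow 2) fun z hz => pow_ne_zero 2 (hN0 z hz)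
  have hrd : ContinuousOn (radialDeriv u) {z | z ≠ 0} := by
    rw [funext (radialDeriv_eq_inv_mul hd)]
    exact (hN.inv₀ hN0).mul h1.continuousOn
  have hA : ContinuousOn (fun z => gPsi z ^ (p / 2) * |radialDeriv u z| ^ p / gNorm z ^ β)
      {z : GPt n | z ≠ 0} :=
    ((hψ.rpow_const fun z _ => Or.inr (by linarith)).mul
      (hrd.abs.rpow_const fun z _ => Or.inr hp.le)).div
      (hN.rpow_const fun z hz => Or.inl (hN0 z hz))
      fun z hz => (rpow_pos_of_pos (gNorm_pos hz) _).ne'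
  rw [← integrableOn_iff_integrable_of_support_subset (s := tsupport u)]
  · exact (hA.mono hu0).integrableOn_compact hc.isCompact
  · intro z hz
    refine support_fderiv_subset ℝ fun h => hz ?_
    simp [radialDeriv_eq_inv_mul hd, h, zero_rpow hp.ne']

theorem dilation_scaling {Q p β γ : ℝ} (hγ : γ * p = Q - p - β) {ρ : ℝ} (hρ : 0 < ρ) (τ v : ℝ) :
    Real.exp (Q * τ) * (|Real.exp (-(γ * τ)) * v| ^ p / (Real.exp τ * ρ) ^ (p + β))
      = |v| ^ p / ρ ^ (p + β) := by
  have h : Real.exp (Q * τ) * Real.exp (-(γ * τ) * p) = Real.exp (τ * (p + β)) := by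
    rw [← Real.exp_add]
    congr 1
    linear_combination (-τ) * hγ
  rw [abs_mul, abs_of_pos (Real.exp_pos _), mul_rpow (Real.exp_pos _).le (abs_nonneg _),
    mul_rpow (Real.exp_pos _).le hρ.le, ← Real.exp_mul, ← Real.exp_mul, ← h]
  have := rpow_pos_of_pos hρ (p + β)
  field_simp

theorem hardy_stability_orbit {n : ℕ} {Q p β γ : ℝ} (hp : 2 ≤ p) (hγ0 : 0 < γ)
    (hγ : γ * p = Q - p - β) {u : GPt n → ℝ} (hu : ContDiff ℝ 1 u) (hc : HasCompactSupport u)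
    (hu0 : tsupport u ⊆ {z | z ≠ 0}) {R : ℝ} (hR : 0 < R) {z : GPt n} (hz : z ≠ 0) :
    ∫⁻ τ, ENNReal.ofReal (Real.exp (Q * τ)) * ENNReal.ofReal
        (γ ^ p * (|u (gDil τ z)| ^ p * gPsi (gDil τ z) ^ (p / 2) / gNorm (gDil τ z) ^ (p + β))
          + cFS p * ((p - 1) / p) ^ p *
          (|u (gDil τ z) - R ^ γ * uScaled R u (gDil τ z) * gNorm (gDil τ z) ^ (-γ)| ^ p *
            gPsi (gDil τ z) ^ (p / 2) /
            (|Real.log (R / gNorm (gDil τ z))| ^ p * gNorm (gDil τ z) ^ (p + β))))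
      ≤ ∫⁻ τ, ENNReal.ofReal (Real.exp (Q * τ)) * ENNReal.ofReal
        (gPsi (gDil τ z) ^ (p / 2) * |radialDeriv u (gDil τ z)| ^ p / gNorm (gDil τ z) ^ β) := by
  have hd := hu.differentiable one_ne_zero
  have hρ := gNorm_pos hz
  have hK : 0 ≤ cFS p * ((p - 1) / p) ^ p :=
    mul_nonneg (cFS_nonneg hp) (rpow_nonneg (div_nonneg (by linarith) (by linarith)) _)
  set ρ := gNorm z with hρdef
  set a := Real.log (R / ρ) with ha
  have hea : Real.exp a = R / ρ := Real.exp_log (div_pos hR hρ)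
  set W := gPsi z ^ (p / 2) / ρ ^ (p + β) with hW
  have hψ0 : 0 ≤ gPsi z ^ (p / 2) := rpow_nonneg (div_nonneg (sq_nonneg _) (sq_nonneg _)) _
  have hW0 : 0 ≤ W := div_nonneg hψ0 (rpow_nonneg hρ.le _)
  set g : ℝ → ℝ := fun τ => Real.exp (γ * τ) * u (gDil τ z) with hg
  have hgu : ∀ τ, u (gDil τ z) = Real.exp (-(γ * τ)) * g τ := by
    intro τ
    rw [hg, ← mul_assoc, ← Real.exp_add, neg_add_cancel, Real.exp_zero, one_mul]
  have hgC : ContDiff ℝ 1 g := by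
    refine ContDiff.mul (by fun_prop) (hu.comp ?_)
    unfold gDil
    fun_prop
  have hgs : HasCompactSupport g :=
    (hasCompactSupport_comp_gDil hc hu0 hz).mul_left
  have hg' : ∀ τ, radialDeriv u (gDil τ z)
      = Real.exp (-(γ * τ)) * (deriv g τ - γ * g τ) / (Real.exp τ * ρ) := by
    intro τ
    have h1 : HasDerivAt (fun τ => Real.exp (γ * τ)) (Real.exp (γ * τ) * (γ * 1)) τ :=
      ((hasDerivAt_id τ).const_mul γ).exp
    have h2 : HasDerivAt g _ τ := h1.mul (hasDerivAt_comp_gDil hd hz τ)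
    rw [h2.deriv, eq_div_iff (by positivity)]
    have e : Real.exp (-(γ * τ)) * Real.exp (γ * τ) = 1 := by
      rw [← Real.exp_add, neg_add_cancel, Real.exp_zero]
    simp only [hg, ← hρdef]
    linear_combination (-(Real.exp τ * ρ * radialDeriv u (gDil τ z))) * e
  have hscaled : ∀ τ, R ^ γ * uScaled R u (gDil τ z) * (Real.exp τ * ρ) ^ (-γ)
      = Real.exp (-(γ * τ)) * g a := by
    intro τ
    have e1 : uScaled R u (gDil τ z) = u (gDil a z) := by
      rw [uScaled, gNorm_gDil, ← hρdef]
      congr 1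
      refine Prod.ext ?_ ?_
      · simp only [gDil, smul_smul, hea]
        congr 1
        field_simp
      · simp only [gDil, hea]
        field_simp
    rw [e1, hgu a, mul_rpow (Real.exp_pos _).le hρ.le, ← Real.exp_mul,
      show -(γ * a) = a * (-γ) by ring, Real.exp_mul, hea, div_rpow hR.le hρ.le,
      rpow_neg hR.le, rpow_neg hρ.le, show τ * -γ = -(γ * τ) by ring]
    have h1 := rpow_pos_of_pos hR γ
    have h2 := rpow_pos_of_pos hρ γ
    field_simp
  have hlog : ∀ τ, |Real.log (R / (Real.exp τ * ρ))| = |τ - a| := by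
    intro τ
    rw [show R / (Real.exp τ * ρ) = R / ρ / Real.exp τ by field_simp,
      Real.log_div (div_pos hR hρ).ne' (Real.exp_pos τ).ne', Real.log_exp, abs_sub_comm]
  have hquot : ∀ τ, |g τ - g a| ^ p / |τ - a| ^ p ≤ |dslope g a τ| ^ p := by
    intro τ
    rcases eq_or_ne τ a with rfl | h
    · simp [zero_rpow (show p ≠ 0 by linarith), rpow_nonneg]
    · rw [dslope_of_ne _ h, slope_def_field, abs_div, div_rpow (abs_nonneg _) (abs_nonneg _)]
  calc _ ≤ ∫⁻ τ, ENNReal.ofReal W * ENNReal.ofReal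
        (γ ^ p * |g τ| ^ p + cFS p * ((p - 1) / p) ^ p * |dslope g a τ| ^ p) := by
        refine lintegral_mono fun τ => ?_
        rw [← ENNReal.ofReal_mul (Real.exp_pos _).le, ← ENNReal.ofReal_mul hW0]
        refine ENNReal.ofReal_le_ofReal ?_
        rw [gPsi_gDil, gNorm_gDil, ← hρdef, hscaled, hlog, hgu τ, ← mul_sub]
        have s1 := dilation_scaling hγ hρ τ (g τ)
        have s2 := dilation_scaling hγ hρ τ (g τ - g a)
        have s3 := mul_le_mul_of_nonneg_left (hquot τ) (mul_nonneg hK hW0)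
        calc _ = γ ^ p * (gPsi z ^ (p / 2) * (Real.exp (Q * τ) *
                (|Real.exp (-(γ * τ)) * g τ| ^ p / (Real.exp τ * ρ) ^ (p + β))))
              + cFS p * ((p - 1) / p) ^ p * (gPsi z ^ (p / 2) / |τ - a| ^ p *
                (Real.exp (Q * τ) * (|Real.exp (-(γ * τ)) * (g τ - g a)| ^ p
                  / (Real.exp τ * ρ) ^ (p + β)))) := by ring
          _ = γ ^ p * (W * |g τ| ^ p) + cFS p * ((p - 1) / p) ^ p * W *
                (|g τ - g a| ^ p / |τ - a| ^ p) := by rw [s1, s2, hW]; ring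
          _ ≤ _ := by linarith
    _ = ENNReal.ofReal W * ∫⁻ τ, ENNReal.ofReal
        (γ ^ p * |g τ| ^ p + cFS p * ((p - 1) / p) ^ p * |dslope g a τ| ^ p) :=
        lintegral_const_mul' _ _ ENNReal.ofReal_ne_top
    _ ≤ ENNReal.ofReal W * ∫⁻ τ, ENNReal.ofReal (|deriv g τ - γ * g τ| ^ p) :=
        mul_le_mul_right (hardy_remainder_line hp hγ0 hgC hgs a) _
    _ = ∫⁻ τ, ENNReal.ofReal W * ENNReal.ofReal (|deriv g τ - γ * g τ| ^ p) :=
        (lintegral_const_mul' _ _ ENNReal.ofReal_ne_top).symm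
    _ = _ := by
        refine lintegral_congr fun τ => ?_
        rw [← ENNReal.ofReal_mul (Real.exp_pos _).le, ← ENNReal.ofReal_mul hW0, gPsi_gDil,
          gNorm_gDil, ← hρdef, hg', abs_div, abs_of_pos (show 0 < Real.exp τ * ρ by positivity),
          div_rpow (abs_nonneg _) (by positivity)]
        congr 1
        have s := dilation_scaling hγ hρ τ (deriv g τ - γ * g τ)
        rw [hW, div_mul_eq_mul_div, mul_div_assoc, ← s,
          rpow_add (show 0 < Real.exp τ * ρ by positivity)]
        field_simp

theorem hardy_stability_of_radius {n : ℕ} {Q p β γ : ℝ} (hQ : Q = n + 2) (hp : 2 ≤ p)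
    (hγ0 : 0 < γ) (hγ : γ * p = Q - p - β) {u : GPt n → ℝ} (hu : ContDiff ℝ 1 u)
    (hc : HasCompactSupport u) (hu0 : tsupport u ⊆ {z | z ≠ 0}) {R : ℝ} (hR : 0 < R) :
    γ ^ p * (∫ z : GPt n, |u z| ^ p * gPsi z ^ (p / 2) / gNorm z ^ (p + β))
      + cFS p * ((p - 1) / p) ^ p *
        (∫ z : GPt n, |u z - R ^ γ * uScaled R u z * gNorm z ^ (-γ)| ^ p *
          gPsi z ^ (p / 2) / (|Real.log (R / gNorm z)| ^ p * gNorm z ^ (p + β)))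
      ≤ ∫ z : GPt n, gPsi z ^ (p / 2) * |radialDeriv u z| ^ p / gNorm z ^ β := by
  have hK : 0 ≤ cFS p * ((p - 1) / p) ^ p :=
    mul_nonneg (cFS_nonneg hp) (rpow_nonneg (div_nonneg (by linarith) (by linarith)) _)
  have mN := (continuous_gNorm (n := n)).measurable
  have mψ := measurable_gPsi (n := n)
  have mr := measurable_radialDeriv hu
  have ms := measurable_uScaled hu.continuous R
  have mu := hu.continuous.measurable
  set A : GPt n → ℝ := fun z => gPsi z ^ (p / 2) * |radialDeriv u z| ^ p / gNorm z ^ β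
  set B : GPt n → ℝ := fun z => |u z| ^ p * gPsi z ^ (p / 2) / gNorm z ^ (p + β)
  set C : GPt n → ℝ := fun z => |u z - R ^ γ * uScaled R u z * gNorm z ^ (-γ)| ^ p *
          gPsi z ^ (p / 2) / (|Real.log (R / gNorm z)| ^ p * gNorm z ^ (p + β))
  set G : GPt n → ℝ := fun z => γ ^ p * B z + cFS p * ((p - 1) / p) ^ p * C z
  have mA : Measurable A := by fun_prop
  have mB : Measurable B := by fun_prop
  have mC : Measurable C := by fun_prop
  have mG : Measurable G := by fun_prop
  have hψ0 : ∀ z : GPt n, 0 ≤ gPsi z ^ (p / 2) := fun z =>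
    rpow_nonneg (div_nonneg (sq_nonneg _) (sq_nonneg _)) _
  have hr0 : ∀ (z : GPt n) (r : ℝ), 0 ≤ gNorm z ^ r := fun z r => rpow_nonneg (gNorm_nonneg z) _
  have ha0 : ∀ x : ℝ, 0 ≤ |x| ^ p := fun x => rpow_nonneg (abs_nonneg x) _
  have A0 : ∀ z, 0 ≤ A z := fun z => div_nonneg (mul_nonneg (hψ0 z) (ha0 _)) (hr0 _ _)
  have B0 : ∀ z, 0 ≤ B z := fun z => div_nonneg (mul_nonneg (ha0 _) (hψ0 z)) (hr0 _ _)
  have C0 : ∀ z, 0 ≤ C z := fun z =>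
    div_nonneg (mul_nonneg (ha0 _) (hψ0 z)) (mul_nonneg (ha0 _) (hr0 _ _))
  have hγp : 0 < γ ^ p := rpow_pos_of_pos hγ0 p
  have G0 : ∀ z, 0 ≤ G z := fun z =>
    add_nonneg (mul_nonneg hγp.le (B0 z)) (mul_nonneg hK (C0 z))
  have iA : Integrable A := integrable_radial_energy (by linarith) β hu hc hu0
  have hle : ∫⁻ z, ENNReal.ofReal (G z) ≤ ∫⁻ z, ENNReal.ofReal (A z) := by
    rw [lintegral_eq_lintegral_orbits mG.ennreal_ofReal,
      lintegral_eq_lintegral_orbits mA.ennreal_ofReal, ← hQ]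
    refine setLIntegral_mono' (mN measurableSet_Ico) fun z hz => ?_
    refine hardy_stability_orbit hp hγ0 hγ hu hc hu0 hR ?_
    rintro rfl
    have h1 : (1 : ℝ) ≤ gNorm (0 : GPt n) := hz.1
    norm_num [gNorm] at h1
  have hfin : ∫⁻ z, ENNReal.ofReal (A z) < ⊤ :=
    (hasFiniteIntegral_iff_ofReal (Filter.Eventually.of_forall A0)).1 iA.2
  have iG : Integrable G := ⟨mG.aestronglyMeasurable,
    (hasFiniteIntegral_iff_ofReal (Filter.Eventually.of_forall G0)).2 (hle.trans_lt hfin)⟩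
  have iB : Integrable fun z => γ ^ p * B z := by
    refine iG.mono' (by fun_prop) (Filter.Eventually.of_forall fun z => ?_)
    rw [Real.norm_of_nonneg (mul_nonneg hγp.le (B0 z))]
    exact le_add_of_nonneg_right (mul_nonneg hK (C0 z))
  have iC : Integrable fun z => cFS p * ((p - 1) / p) ^ p * C z := by
    refine iG.mono' (by fun_prop) (Filter.Eventually.of_forall fun z => ?_)
    rw [Real.norm_of_nonneg (mul_nonneg hK (C0 z))]
    exact le_add_of_nonneg_left (mul_nonneg hγp.le (B0 z))
  calc _ = ∫ z, G z := by
        rw [← integral_const_mul, ← integral_const_mul, ← integral_add iB iC]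
    _ ≤ ∫ z, A z := by
        rw [integral_eq_lintegral_of_nonneg_ae (Filter.Eventually.of_forall G0)
            mG.aestronglyMeasurable,
          integral_eq_lintegral_of_nonneg_ae (Filter.Eventually.of_forall A0)
            mA.aestronglyMeasurable]
        exact ENNReal.toReal_mono hfin.ne hle

/-- stability of the subcritical weighted Hardy inequality
(Theorem 1.2 of the paper). -/
theorem stability_subcritical_hardy
    (n : ℕ) (Q : ℝ) (hQ : Q = n + 2) (hQ4 : 4 ≤ Q)
    (p β : ℝ) (hp2 : 2 ≤ p) (hpQ : p < Q) (hβ : β < Q - p)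
    (u : GPt n → ℝ) (hu : IsTest {z : GPt n | z ≠ 0} u) :
    (∫ z : GPt n, gPsi z ^ (p / 2) * |radialDeriv u z| ^ p / gNorm z ^ β)
        - ((Q - p - β) / p) ^ p *
            ∫ z : GPt n, |u z| ^ p * gPsi z ^ (p / 2) / gNorm z ^ (p + β)
      ≥ cFS p * ((p - 1) / p) ^ p * ⨆ R > (0 : ℝ), dH Q p β R u ^ p := by
  have hp0 : 0 < p := by linarith
  have hγ0 : 0 < (Q - p - β) / p := div_pos (by linarith) hp0
  have hγ : (Q - p - β) / p * p = Q - p - β := div_mul_cancel₀ _ hp0.ne'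
  have hK : 0 ≤ cFS p * ((p - 1) / p) ^ p :=
    mul_nonneg (cFS_nonneg hp2) (rpow_nonneg (div_nonneg (by linarith) hp0.le) _)
  have hdH : ∀ R, 0 ≤ dH Q p β R u ^ p ∧ dH Q p β R u ^ p =
      ∫ z : GPt n, |u z - R ^ ((Q - p - β) / p) * uScaled R u z *
        gNorm z ^ (-((Q - p - β) / p))| ^ p * gPsi z ^ (p / 2) /
        (|Real.log (R / gNorm z)| ^ p * gNorm z ^ (p + β)) := by
    intro R
    have hI : 0 ≤ ∫ z : GPt n, |u z - R ^ ((Q - p - β) / p) * uScaled R u z *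
        gNorm z ^ (-((Q - p - β) / p))| ^ p * gPsi z ^ (p / 2) /
        (|Real.log (R / gNorm z)| ^ p * gNorm z ^ (p + β)) :=
      integral_nonneg fun z => div_nonneg
        (mul_nonneg (rpow_nonneg (abs_nonneg _) _)
          (rpow_nonneg (div_nonneg (sq_nonneg _) (sq_nonneg _)) _))
        (mul_nonneg (rpow_nonneg (abs_nonneg _) _) (rpow_nonneg (gNorm_nonneg z) _))
    have h := rpow_inv_rpow hI hp0.ne'
    rw [dH, one_div, h]
    exact ⟨hI, rfl⟩
  have key : ∀ R, 0 < R → cFS p * ((p - 1) / p) ^ p * dH Q p β R u ^ p ≤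
      (∫ z : GPt n, gPsi z ^ (p / 2) * |radialDeriv u z| ^ p / gNorm z ^ β)
        - ((Q - p - β) / p) ^ p *
            ∫ z : GPt n, |u z| ^ p * gPsi z ^ (p / 2) / gNorm z ^ (p + β) := by
    intro R hR
    rw [(hdH R).2, le_sub_iff_add_le']
    exact hardy_stability_of_radius hQ hp2 hγ0 hγ (hu.1.of_le (by exact_mod_cast le_top))
      hu.2.1 hu.2.2 hR
  have hnonneg := (mul_nonneg hK (hdH 1).1).trans (key 1 one_pos)
  rw [ge_iff_le, Real.mul_iSup_of_nonneg hK]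
  refine Real.iSup_le (fun R => ?_) hnonneg
  rw [Real.mul_iSup_of_nonneg hK]
  exact Real.iSup_le (fun hR => key R hR) hnonneg
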